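/- arXiv:0802.0734 — 3 statements merged into one kernel-verified Lean document; each statement's English description precedes it below -/
import Mathlib

section
/- Let V be a Jordan triple system, let w ∈ V be a tripotent, and let u ∈ V be a tripotent with D(w,w)u = u/2 and {u,w,u} = 0. Then, with w_u := 2{u,u,w}, one has {u,w,w_u} = {w,w_u,u} = {w_u,w,u} = u/2. -/
/-- A Jordan triple system: a complex vector space with a triple product
symmetric and linear in the outer variables, conjugate-linear in the middle
variable, satisfying the Jordan triple (main) identity. -/
structure JordanTriple (V : Type*) [AddCommGroup V] [Module ℂ V] where
  tp : V → V → V → V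
  symm_outer : ∀ a b c, tp a b c = tp c b a
  add_fst : ∀ a a' b c, tp (a + a') b c = tp a b c + tp a' b c
  smul_fst : ∀ (r : ℂ) (a b c : V), tp (r • a) b c = r • tp a b c
  add_snd : ∀ a b b' c, tp a (b + b') c = tp a b c + tp a b' c
  smul_snd : ∀ (r : ℂ) (a b c : V), tp a (r • b) c = (starRingEnd ℂ r) • tp a b c
  jordan_identity : ∀ a b x y z,
    tp a b (tp x y z) = tp (tp a b x) y z - tp x (tp b a y) z + tp x y (tp a b z)

namespace JordanTriple

variable {V : Type*} [AddCommGroup V] [Module ℂ V]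

/-- A tripotent: `{e,e,e} = e`. -/
def IsTripotent (T : JordanTriple V) (e : V) : Prop := T.tp e e e = e

/-- Orthogonality of elements: `D(x,y) = 0` and `D(y,x) = 0`. -/
def Orthogonal (T : JordanTriple V) (x y : V) : Prop :=
  (∀ z, T.tp x y z = 0) ∧ (∀ z, T.tp y x z = 0)

/-- A maximal (complete) tripotent: the Peirce projection
`P₀(w) = I - 2 D(w,w) + Q(w)²` vanishes on `V`. -/
def IsMaximalTripotent (T : JordanTriple V) (w : V) : Prop :=
  T.IsTripotent w ∧ ∀ z : V, z - (2 : ℂ) • T.tp w w z + T.tp w (T.tp w z w) w = 0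

/-- Orthogonality is symmetric: `D(a,a)b = 0` implies `D(b,b)a = 0`
(true in every JB*-triple). -/
def OrthSymm (T : JordanTriple V) : Prop :=
  ∀ a b : V, T.tp a a b = 0 → T.tp b b a = 0

end JordanTriple

variable {V : Type*} [AddCommGroup V] [Module ℂ V]

open JordanTriple

/-- If `w` is a tripotent, `u` a tripotent with `D(w,w)u = u/2` and `{u,w,u} = 0`,
then with `w_u := 2{u,u,w}` one has `{u,w,w_u} = {w,w_u,u} = {w_u,w,u} = u/2`. -/
theorem triple_products_half_u (T : JordanTriple V) (w u : V)
    (hw : T.IsTripotent w) (hu : T.IsTripotent u)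
    (h1 : T.tp w w u = (1/2 : ℂ) • u) (h2 : T.tp u w u = 0)
    (wu : V) (hwu : wu = (2 : ℂ) • T.tp u u w) :
    T.tp u w wu = (1/2 : ℂ) • u ∧
    T.tp w wu u = (1/2 : ℂ) • u ∧
    T.tp wu w u = (1/2 : ℂ) • u := by
  have h1' : T.tp u w w = (1/2 : ℂ) • u := by rw [T.symm_outer, h1]
  have smul_thd (r : ℂ) (a b c : V) : T.tp a b (r • c) = r • T.tp a b c := by
    rw [T.symm_outer, T.smul_fst, T.symm_outer]
  have zero_fst (b c : V) : T.tp 0 b c = 0 := by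
    simpa using T.smul_fst 0 0 b c
  unfold IsTripotent at hu
  have hsum := T.jordan_identity u w u u w
  have hdiff := T.jordan_identity u u u w w
  rw [h2, zero_fst, h1', smul_thd, hu, T.symm_outer w u u] at hsum
  rw [h1', smul_thd, hu, h1'] at hdiff
  have heq : T.tp u w (T.tp u u w) = T.tp u (T.tp u u w) w := by
    linear_combination (norm := module) -hdiff
  have hquarter : T.tp u w (T.tp u u w) = (1/4 : ℂ) • u := by
    linear_combination (norm := module) (1/2 : ℂ) • hsum + (1/2 : ℂ) • heq
  have hfirst : T.tp u w wu = (1/2 : ℂ) • u := by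
    rw [hwu, smul_thd, hquarter]
    module
  refine ⟨hfirst, ?_, by rw [T.symm_outer, hfirst]⟩
  rw [hwu, T.smul_snd, T.symm_outer, ← heq, hquarter, Complex.conj_ofNat]
  module
end

section
/- Let V be a Jordan triple system, let w ∈ V be a maximal tripotent, and let u ∈ V be a tripotent with D(w,w)u = u/2. Then the Peirce space V_2(u) is contained in V_1(w): every x ∈ V with D(u,u)x = x satisfies D(w,w)x = x/2. -/
variable {V : Type*} [AddCommGroup V] [Module ℂ V]

open JordanTriple

namespace JordanTriple

/-- The triple product as a linear map in its third variable, `D(a,b)`. -/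
def dMap (T : JordanTriple V) (a b : V) : V →ₗ[ℂ] V where
  toFun z := T.tp a b z
  map_add' x y := by
    rw [T.symm_outer, T.add_fst, T.symm_outer x, T.symm_outer y]
  map_smul' r x := by
    rw [T.symm_outer, T.smul_fst, T.symm_outer x, RingHom.id_apply]

/-- The conjugate-linear map `Q(a)`. -/
def qMap (T : JordanTriple V) (a : V) : V →ₛₗ[starRingEnd ℂ] V where
  toFun z := T.tp a z a
  map_add' x y := T.add_snd a x y a
  map_smul' r x := T.smul_snd r a x a

/-- For a tripotent `e`, `Q(e)² = 2 D(e,e)² - D(e,e)`. -/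
theorem IsTripotent.qMap_qMap {T : JordanTriple V} {e : V} (he : T.IsTripotent e) (z : V) :
    T.qMap e (T.qMap e z) = (2 : ℂ) • T.dMap e e (T.dMap e e z) - T.dMap e e z := by
  have h := T.jordan_identity z e e e e
  rw [show T.tp e e e = e from he, T.symm_outer z e e,
    T.symm_outer (T.tp e e z) e e, T.symm_outer e e (T.tp e e z),
    T.symm_outer (T.tp e e z) e e] at h
  change T.tp e (T.tp e z e) e = (2 : ℂ) • T.tp e e (T.tp e e z) - T.tp e e z
  linear_combination (norm := module) h

/-- For a maximal tripotent `w`, `(2 D(w,w) - 1) (D(w,w) - 1) = 0`. -/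
theorem IsMaximalTripotent.dMap_dMap {T : JordanTriple V} {w : V}
    (hw : T.IsMaximalTripotent w) (z : V) :
    (2 : ℂ) • T.dMap w w (T.dMap w w z) = (3 : ℂ) • T.dMap w w z - z := by
  have h : z - (2 : ℂ) • T.dMap w w z + T.qMap w (T.qMap w z) = 0 := hw.2 z
  rw [hw.1.qMap_qMap] at h
  linear_combination (norm := module) h

/-- If `u ∈ V₁(w)`, then `D(w,w) Q(u) = Q(u) (1 - D(w,w))`. -/
theorem dMap_qMap_of_peirce_one {T : JordanTriple V} {w u : V}
    (h1 : T.tp w w u = (1/2 : ℂ) • u) (x : V) :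
    T.dMap w w (T.qMap u x) = T.qMap u x - T.qMap u (T.dMap w w x) := by
  have h := T.jordan_identity w w u x u
  rw [h1, T.smul_fst, T.symm_outer u x ((1/2 : ℂ) • u), T.smul_fst] at h
  change T.tp w w (T.tp u x u) = T.tp u x u - T.tp u (T.tp w w x) u
  rw [h]
  module

/-- If `w` is a maximal tripotent and `u ∈ V₁(w)`, then `Q(u)` maps `V` into `V₁(w)`. -/
theorem IsMaximalTripotent.dMap_qMap {T : JordanTriple V} {w u : V}
    (hw : T.IsMaximalTripotent w) (h1 : T.tp w w u = (1/2 : ℂ) • u) (x : V) :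
    T.dMap w w (T.qMap u x) = (1/2 : ℂ) • T.qMap u x := by
  have hy := hw.dMap_dMap (T.qMap u x)
  have hx := congrArg (T.qMap u) (hw.dMap_dMap x)
  simp only [map_sub, LinearMap.map_smulₛₗ, map_ofNat] at hx
  simp only [dMap_qMap_of_peirce_one h1, map_sub] at hy ⊢
  linear_combination (norm := module) (1/2 : ℂ) • hx - (1/2 : ℂ) • hy

end JordanTriple

/-- If `w` is a maximal tripotent and `u` is a tripotent with `D(w,w)u = u/2`,
then `V₂(u) ⊆ V₁(w)`. -/
theorem peirce_two_subset_peirce_one_of_max (T : JordanTriple V) (w u : V)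
    (hw : T.IsMaximalTripotent w) (hu : T.IsTripotent u)
    (h1 : T.tp w w u = (1/2 : ℂ) • u) :
    ∀ x : V, T.tp u u x = x → T.tp w w x = (1/2 : ℂ) • x := by
  intro x hx
  have hq : T.qMap u (T.qMap u x) = x := by
    rw [hu.qMap_qMap, show T.dMap u u x = x from hx, show T.dMap u u x = x from hx]
    module
  have h := hw.dMap_qMap h1 (T.qMap u x)
  rwa [hq] at h
end

section
/- Let V be a Jordan triple system, let w ∈ V be a maximal tripotent, and let u ∈ V be a tripotent with D(w,w)u = u/2. Set w_u = 2{u,u,w}. Then the Peirce space V_2(u) is contained in V_1(w_u): every x ∈ V with D(u,u)x = x satisfies D(w_u,w_u)x = x/2. -/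
variable {V : Type*} [AddCommGroup V] [Module ℂ V]

open JordanTriple

namespace JordanTriple

theorem zero_fst (T : JordanTriple V) (b c : V) : T.tp 0 b c = 0 := by
  simpa using T.smul_fst 0 0 b c

theorem zero_snd (T : JordanTriple V) (a c : V) : T.tp a 0 c = 0 := by
  simpa using T.smul_snd 0 a 0 c

theorem zero_trd (T : JordanTriple V) (a b : V) : T.tp a b 0 = 0 := by
  rw [T.symm_outer, T.zero_fst]

theorem add_trd (T : JordanTriple V) (a b c c' : V) :
    T.tp a b (c + c') = T.tp a b c + T.tp a b c' := by
  rw [T.symm_outer, T.add_fst, T.symm_outer c, T.symm_outer c']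

theorem smul_trd (T : JordanTriple V) (r : ℂ) (a b c : V) :
    T.tp a b (r • c) = r • T.tp a b c := by
  rw [T.symm_outer, T.smul_fst, T.symm_outer c]

theorem sub_trd (T : JordanTriple V) (a b c c' : V) :
    T.tp a b (c - c') = T.tp a b c - T.tp a b c' := by
  have h := T.add_trd a b (c - c') c'
  rw [sub_add_cancel] at h
  rw [h, add_sub_cancel_right]

theorem half_smul_snd (T : JordanTriple V) (a b c : V) :
    T.tp a ((1/2 : ℂ) • b) c = (1/2 : ℂ) • T.tp a b c := by
  have h : (starRingEnd ℂ) 2 = 2 := Complex.conj_ofNat 2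
  rw [T.smul_snd]
  simp [h]

/-- For a tripotent `e`, `Q(e)² = 2 D(e,e)² - D(e,e)`. -/
theorem IsTripotent.quad_quad {T : JordanTriple V} {e : V} (he : T.IsTripotent e) (x : V) :
    T.tp e (T.tp e x e) e = (2 : ℂ) • T.tp e e (T.tp e e x) - T.tp e e x := by
  have h := T.jordan_identity x e e e e
  have he' : T.tp e e e = e := he
  rw [he', T.symm_outer x e e, T.symm_outer (T.tp e e x) e e] at h
  linear_combination (norm := module) h

/-- For a tripotent `e`, the range of `Q(e)` lies in the Peirce space `V₂(e)`. -/
theorem IsTripotent.tp_quad {T : JordanTriple V} {e : V} (he : T.IsTripotent e) (x : V) :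
    T.tp e e (T.tp e x e) = T.tp e x e := by
  have he' : T.tp e e e = e := he
  have h₁ := T.jordan_identity e e e x e
  have h₂ := T.jordan_identity e x e e e
  rw [he'] at h₁ h₂
  rw [T.symm_outer (T.tp e x e) e e, T.symm_outer x e e] at h₂
  linear_combination (norm := module) (1/3 : ℂ) • h₁ - (1/3 : ℂ) • h₂

/-- `Q(e)² = 1` on the Peirce space `V₂(e)`. -/
theorem IsTripotent.quad_quad_of_peirce_two {T : JordanTriple V} {e x : V}
    (he : T.IsTripotent e) (hx : T.tp e e x = x) : T.tp e (T.tp e x e) e = x := by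
  rw [he.quad_quad, hx, hx]
  module

/-- `D(e,a) = 0` for `a` in the Peirce space `V₀(e)`. -/
theorem IsTripotent.tp_peirce_zero {T : JordanTriple V} {e a : V} (he : T.IsTripotent e)
    (ha : T.tp e e a = 0) (z : V) : T.tp e a z = 0 := by
  have he' : T.tp e e e = e := he
  have hq : T.tp e a e = 0 := by
    have h := T.jordan_identity e e e a e
    rw [he.tp_quad, he', ha, T.zero_snd] at h
    linear_combination (norm := module) -h
  have h₁ := T.jordan_identity e e e a z
  have h₂ := T.jordan_identity e a e e z
  rw [he', ha, T.zero_snd] at h₁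
  rw [hq, T.zero_fst, T.symm_outer a e e, ha, T.zero_snd] at h₂
  linear_combination (norm := module) -h₁ - h₂

/-- `D(V₂(e), V₀(e)) = 0` for a tripotent `e`. -/
theorem IsTripotent.tp_peirce_two_zero {T : JordanTriple V} {e a x : V} (he : T.IsTripotent e)
    (ha : T.tp e e a = 0) (hx : T.tp e e x = x) (z : V) : T.tp x a z = 0 := by
  have hb : T.tp e e (T.tp e x a) = 0 := by
    have he' : T.tp e e e = e := he
    rw [T.jordan_identity, he', hx, ha, T.zero_trd]
    module
  have h := T.jordan_identity x e e a z
  rw [he.tp_peirce_zero ha, he.tp_peirce_zero ha, T.zero_trd, T.symm_outer x e e, hx,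
    he.tp_peirce_zero hb] at h
  linear_combination (norm := module) -h

/-- For a maximal tripotent `w`, `V = V₁(w) + V₂(w)`: the operator `D(w,w)` is annihilated
by `(2X - 1)(X - 1)`. -/
theorem IsMaximalTripotent.tp_tp {T : JordanTriple V} {w : V} (hw : T.IsMaximalTripotent w)
    (z : V) : z - (3 : ℂ) • T.tp w w z + (2 : ℂ) • T.tp w w (T.tp w w z) = 0 := by
  have h := hw.2 z
  rw [hw.1.quad_quad] at h
  linear_combination (norm := module) h

theorem IsMaximalTripotent.eq_zero {T : JordanTriple V} {w z : V} (hw : T.IsMaximalTripotent w)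
    (hz : T.tp w w z = 0) : z = 0 := by
  have h := hw.tp_tp z
  rw [hz, T.zero_trd] at h
  linear_combination (norm := module) h

/-- If `w` is a maximal tripotent and `u ∈ V₁(w)` is a tripotent, then `V₂(u) ⊆ V₁(w)`. -/
theorem IsMaximalTripotent.tp_of_peirce_two {T : JordanTriple V} {w u x : V}
    (hw : T.IsMaximalTripotent w) (hu : T.IsTripotent u) (h1 : T.tp w w u = (1/2 : ℂ) • u)
    (hx : T.tp u u x = x) : T.tp w w x = (1/2 : ℂ) • x := by
  have hwx : T.tp u u (T.tp w w x) = T.tp w w x := by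
    have h := T.jordan_identity w w u u x
    rw [h1, hx, T.half_smul_snd, T.smul_fst] at h
    linear_combination (norm := module) -h
  set y := (2 : ℂ) • T.tp w w x - x with hy
  have hy_w : T.tp w w y = y := by
    rw [hy, T.sub_trd, T.smul_trd]
    linear_combination (norm := module) hw.tp_tp x
  have hy_u : T.tp u u y = y := by
    rw [hy, T.sub_trd, T.smul_trd, hwx, hx]
  have hq : T.tp u y u = 0 := by
    apply hw.eq_zero
    rw [T.jordan_identity, h1, hy_w, T.smul_fst, T.smul_trd]
    module
  have hy0 := hu.quad_quad_of_peirce_two hy_u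
  rw [hq, T.zero_snd] at hy0
  linear_combination (norm := module) (-1/2 : ℂ) • hy0 - (1/2 : ℂ) • hy

end JordanTriple

/-- If `w` is a maximal tripotent and `u` is a tripotent with `D(w,w)u = u/2`,
then with `w_u = 2{u,u,w}` one has `V₂(u) ⊆ V₁(w_u)`. -/
theorem peirce_two_u_subset_peirce_one_wu (T : JordanTriple V) (w u : V)
    (hw : T.IsMaximalTripotent w) (hu : T.IsTripotent u)
    (h1 : T.tp w w u = (1/2 : ℂ) • u)
    (wu : V) (hwu : wu = (2 : ℂ) • T.tp u u w) :
    ∀ x : V, T.tp u u x = x → T.tp wu wu x = (1/2 : ℂ) • x := by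
  intro x hx
  have hq : T.tp u w u = 0 := by
    apply hw.eq_zero
    have hw' : T.tp w w w = w := hw.1
    rw [T.jordan_identity, h1, hw', T.smul_fst, T.smul_trd]
    module
  have hwu_half : T.tp u u wu = (1/2 : ℂ) • wu := by
    have h := hu.quad_quad w
    rw [hq, T.zero_snd] at h
    rw [hwu, T.smul_trd]
    linear_combination (norm := module) -h
  obtain ⟨v, hv⟩ : ∃ v, v = w - wu := ⟨_, rfl⟩
  have hv0 : T.tp u u v = 0 := by
    rw [hv, T.sub_trd, hwu_half, hwu]
    module
  have hsum : T.tp wu wu x + T.tp v wu x = (1/2 : ℂ) • x := by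
    have h := hw.tp_of_peirce_two hu h1 hx
    have hw_eq : w = wu + v := by rw [hv]; abel
    rw [hw_eq, T.add_snd, T.symm_outer _ v x, hu.tp_peirce_two_zero hv0 hx, T.add_fst] at h
    linear_combination (norm := module) h
  have hsum' := congrArg (T.tp u u) hsum
  rw [T.add_trd, T.smul_trd, T.jordan_identity u u wu wu x, T.jordan_identity u u v wu x,
    hwu_half, hv0, hx, T.smul_fst, T.half_smul_snd, T.half_smul_snd, T.zero_fst] at hsum'
  linear_combination (norm := module) (2 : ℂ) • hsum' - hsum
end
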